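/- Let A be a commutative ring and S ⊆ A[t] a submonoid of the multiplicative monoid of A[t] all of whose elements are monic polynomials. Let X, Y be bounded nonnegatively graded chain complexes of A[t]-modules each of whose terms is finitely generated projective as an A-module, such that there exist p, p′ ∈ S with p·H_q(X) = 0 and p′·H_q(Y) = 0 for all q. Let f : X → Y be an A[t]-linear chain map which is m-connected. Then there exist an integer n ≥ m, chain complexes Z_m = X, Z_{m+1}, …, Z_n of A[t]-modules each of whose terms is finitely generated projective as an A-module, A[t]-linear chain maps Z_{q−1} → Z_q for m < q ≤ n, and an A[t]-linear quasi-isomorphism Z_n → Y, whose composite equals f, such that for each q with m < q ≤ n the homology of cone(Z_{q−1} → Z_q) vanishes in all degrees except q, where it is finitely generated projective as an A-module and is annihilated by some element of S. -/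

import Mathlib

open CategoryTheory Limits

universe u

instance instDecRelDownInt : DecidableRel (ComplexShape.down ℤ).Rel :=
  fun a b => inferInstanceAs (Decidable (b + 1 = a))

instance instHasCofiber {A : Type u} [Ring A] {X Y : ChainComplex (ModuleCat.{u} A) ℤ}
    (f : X ⟶ Y) : HomologicalComplex.HasHomotopyCofiber f :=
  @HomologicalComplex.instHasHomotopyCofiberOfHasBinaryBiproducts _ _ _ _ _ _ _ _ inferInstance

/-- The mapping cone of a chain map: in degree `q` it is `Y_q ⊕ X_{q−1}`. -/
noncomputable def Cone {A : Type u} [Ring A] {X Y : ChainComplex (ModuleCat.{u} A) ℤ}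
    (f : X ⟶ Y) : ChainComplex (ModuleCat.{u} A) ℤ :=
  HomologicalComplex.homotopyCofiber f

/-- The composite `Z 0 ⟶ Z N` of a chain of maps `Z j ⟶ Z (j+1)`. -/
noncomputable def compChain {A : Type u} [Ring A]
    (Z : ℕ → ChainComplex (ModuleCat.{u} A) ℤ) (φ : ∀ j, Z j ⟶ Z (j + 1)) :
    ∀ N, Z 0 ⟶ Z N
  | 0 => 𝟙 _
  | (N + 1) => compChain Z φ N ≫ φ N

/-- A module over `A[t]` is finitely generated projective as an `A`-module (restriction of
scalars along `A → A[t]`). -/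
def FGProjOverA (A : Type u) [CommRing A] (M : ModuleCat.{u} (Polynomial A)) : Prop :=
  Module.Finite A ((ModuleCat.restrictScalars.{u} (algebraMap A (Polynomial A))).obj M) ∧
  Module.Projective A ((ModuleCat.restrictScalars.{u} (algebraMap A (Polynomial A))).obj M)

set_option linter.unusedSimpArgs false

open Polynomial

noncomputable section

namespace Stmt12

/-- `A`-module structure on an `A[X]`-module. -/
instance modA {A : Type u} [CommRing A] (M : ModuleCat.{u} A[X]) : Module A M :=
  Module.compHom M (algebraMap A A[X])

instance towerA {A : Type u} [CommRing A] (M : ModuleCat.{u} A[X]) : IsScalarTower A A[X] M where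
  smul_assoc a p x := by
    rw [Algebra.smul_def, mul_smul]
    rfl

theorem fgProj_iff {A : Type u} [CommRing A] (M : ModuleCat.{u} A[X]) :
    FGProjOverA A M ↔ Module.Finite A M ∧ Module.Projective A M := Iff.rfl

section gen

variable {R : Type u} [Ring R]

theorem homology_pi_sc (S : ShortComplex (ModuleCat.{u} R)) :
    ∃ π : LinearMap.ker S.g.hom →ₗ[R] S.homology, Function.Surjective π ∧
      ∀ c, π c = 0 ↔ ∃ b, S.f.hom b = c.1 := by
  let e : S.homology ≃ₗ[R] (LinearMap.ker S.g.hom ⧸ LinearMap.range S.moduleCatToCycles) :=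
    S.moduleCatHomologyIso.toLinearEquiv
  refine ⟨e.symm.toLinearMap ∘ₗ Submodule.mkQ (LinearMap.range S.moduleCatToCycles), ?_, ?_⟩
  · exact e.symm.surjective.comp (Submodule.mkQ_surjective _)
  · intro c
    rw [LinearMap.comp_apply, LinearEquiv.coe_coe, LinearEquiv.map_eq_zero_iff,
      Submodule.mkQ_apply, Submodule.Quotient.mk_eq_zero]
    constructor
    · rintro ⟨b, hb⟩
      exact ⟨b, congrArg Subtype.val hb⟩
    · rintro ⟨b, hb⟩
      exact ⟨b, Subtype.ext hb⟩

theorem homology_pi (C : ChainComplex (ModuleCat.{u} R) ℤ) (i j k : ℤ) (hij : j + 1 = i)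
    (hki : i + 1 = k) :
    ∃ π : LinearMap.ker (C.d i j).hom →ₗ[R] C.homology i, Function.Surjective π ∧
      ∀ c, π c = 0 ↔ ∃ b, C.d k i b = c.1 := by
  have hp : (ComplexShape.down ℤ).prev i = k := ComplexShape.prev_eq' _ hki
  have hn : (ComplexShape.down ℤ).next i = j := ComplexShape.next_eq' _ hij
  let e : C.homology i ≃ₗ[R] (C.sc' k i j).homology := (C.homologyIsoSc' k i j hp hn).toLinearEquiv
  obtain ⟨π, hs, hk⟩ : ∃ π : LinearMap.ker (C.d i j).hom →ₗ[R] (C.sc' k i j).homology,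
      Function.Surjective π ∧ ∀ c, π c = 0 ↔ ∃ b, (C.d k i).hom b = c.1 :=
    homology_pi_sc (C.sc' k i j)
  refine ⟨e.symm.toLinearMap ∘ₗ π, e.symm.surjective.comp hs, fun c => ?_⟩
  rw [LinearMap.comp_apply, LinearEquiv.coe_coe, LinearEquiv.map_eq_zero_iff]
  exact hk c

theorem homology_isZero_iff (C : ChainComplex (ModuleCat.{u} R) ℤ) (i j k : ℤ) (hij : j + 1 = i)
    (hki : i + 1 = k) :
    IsZero (C.homology i) ↔ ∀ c : C.X i, C.d i j c = 0 → ∃ b, C.d k i b = c := by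
  obtain ⟨π, hs, hk⟩ := homology_pi C i j k hij hki
  constructor
  · intro hz c hc
    have := ModuleCat.subsingleton_of_isZero hz
    exact (hk ⟨c, hc⟩).1 (Subsingleton.elim _ _)
  · intro h
    have : Subsingleton (C.homology i) := by
      refine subsingleton_of_forall_eq 0 fun x => ?_
      obtain ⟨c, rfl⟩ := hs x
      exact (hk c).2 (h c.1 c.2)
    exact ModuleCat.isZero_of_subsingleton _

theorem homology_kill_iff {R : Type u} [CommRing R]
    (C : ChainComplex (ModuleCat.{u} R) ℤ) (i j k : ℤ) (hij : j + 1 = i)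
    (hki : i + 1 = k) (s : R) :
    (∀ x : C.homology i, s • x = 0) ↔ ∀ c : C.X i, C.d i j c = 0 → ∃ b, C.d k i b = s • c := by
  obtain ⟨π, hs, hk⟩ := homology_pi C i j k hij hki
  constructor
  · intro hz c hc
    exact (hk (s • ⟨c, hc⟩)).1 (by rw [map_smul, hz])
  · intro h x
    obtain ⟨c, rfl⟩ := hs x
    rw [← map_smul]
    exact (hk _).2 (h c.1 c.2)

variable {X Y : ChainComplex (ModuleCat.{u} R) ℤ} (f : X ⟶ Y)

open HomologicalComplex.homotopyCofiber in
/-- Elements of the cone as pairs (auxiliary). -/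
def coneEquivAux (i j : ℤ) (hij : (ComplexShape.down ℤ).Rel i j) :
    (HomologicalComplex.homotopyCofiber.X f i : ModuleCat.{u} R) ≃ₗ[R] X.X j × Y.X i :=
  LinearEquiv.ofLinearMap
    (LinearMap.prod (fstX f i j hij).hom (sndX f i).hom)
    (LinearMap.coprod (inlX f j i hij).hom (inrX f i).hom)
    (by
      have h1 := congrArg (fun g => g.hom) (inlX_fstX f j i hij)
      have h2 := congrArg (fun g => g.hom) (inlX_sndX f j i hij)
      have h3 := congrArg (fun g => g.hom) (inrX_fstX f i j hij)
      have h4 := congrArg (fun g => g.hom) (inrX_sndX f i)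
      apply LinearMap.prod_ext <;> ext x
      · have := LinearMap.congr_fun h1 x
        simp only [ModuleCat.hom_comp, LinearMap.comp_apply, ModuleCat.hom_id, LinearMap.id_apply,
          ModuleCat.hom_zero, LinearMap.zero_apply] at this
        simpa using this
      · have := LinearMap.congr_fun h2 x
        simp only [ModuleCat.hom_comp, LinearMap.comp_apply, ModuleCat.hom_id, LinearMap.id_apply,
          ModuleCat.hom_zero, LinearMap.zero_apply] at this
        simpa using this
      · have := LinearMap.congr_fun h3 x
        simp only [ModuleCat.hom_comp, LinearMap.comp_apply, ModuleCat.hom_id, LinearMap.id_apply,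
          ModuleCat.hom_zero, LinearMap.zero_apply] at this
        simpa using this
      · have := LinearMap.congr_fun h4 x
        simp only [ModuleCat.hom_comp, LinearMap.comp_apply, ModuleCat.hom_id, LinearMap.id_apply] at this
        simpa using this)
    (by
      have h : fstX f i j hij ≫ inlX f j i hij + sndX f i ≫ inrX f i = 𝟙 _ := by
        apply ext_to_X f i j hij <;> simp
      ext c
      have := LinearMap.congr_fun (congrArg (fun g => g.hom) h) c
      simpa using this)

/-- Elements of the cone as pairs. -/
def coneEquiv (i j : ℤ) (hij : j + 1 = i) : (Cone f).X i ≃ₗ[R] X.X j × Y.X i :=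
  coneEquivAux f i j hij

theorem coneEquiv_d (i j l : ℤ) (hij : j + 1 = i) (hjl : l + 1 = j) (c : (Cone f).X i) :
    coneEquiv f j l hjl ((Cone f).d i j c) =
      (- X.d j l (coneEquiv f i j hij c).1,
        f.f j (coneEquiv f i j hij c).1 + Y.d i j (coneEquiv f i j hij c).2) := by
  have h1 := congrArg (fun g => g.hom c) (HomologicalComplex.homotopyCofiber.d_fstX f i j l hij hjl)
  have h2 := congrArg (fun g => g.hom c) (HomologicalComplex.homotopyCofiber.d_sndX f i j hij)
  apply Prod.ext
  · exact h1
  · exact h2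

theorem cone_isZero_iff (i j k l : ℤ) (hij : j + 1 = i) (hki : i + 1 = k) (hjl : l + 1 = j) :
    IsZero ((Cone f).homology i) ↔ ∀ (x : X.X j) (y : Y.X i), X.d j l x = 0 →
      f.f j x + Y.d i j y = 0 → ∃ (x' : X.X i) (y' : Y.X k), - X.d i j x' = x ∧
        f.f i x' + Y.d k i y' = y := by
  rw [homology_isZero_iff _ i j k hij hki]
  constructor
  · intro h x y hx hy
    obtain ⟨b, hb⟩ := h ((coneEquiv f i j hij).symm (x, y)) (by
      apply (coneEquiv f j l hjl).injective
      rw [coneEquiv_d f i j l hij hjl]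
      simp [hx, hy])
    have := coneEquiv_d f k i j hki hij b
    rw [hb] at this
    simp only [LinearEquiv.apply_symm_apply] at this
    obtain ⟨h1, h2⟩ := Prod.ext_iff.1 this
    exact ⟨_, _, h1.symm, h2.symm⟩
  · intro h c hc
    have h0 := coneEquiv_d f i j l hij hjl c
    rw [hc, map_zero] at h0
    obtain ⟨h1, h2⟩ := Prod.ext_iff.1 h0
    simp only [Prod.fst_zero, Prod.snd_zero] at h1 h2
    obtain ⟨x', y', hx, hy⟩ := h _ _ (neg_eq_zero.1 h1.symm) h2.symm
    refine ⟨(coneEquiv f k i hki).symm (x', y'), ?_⟩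
    apply (coneEquiv f i j hij).injective
    rw [coneEquiv_d f k i j hki hij]
    simp [hx, hy]

end gen

section kill
variable {R : Type u} [CommRing R]
variable {X Y : ChainComplex (ModuleCat.{u} R) ℤ} (f : X ⟶ Y)

theorem cone_kill_iff (i j k l : ℤ) (hij : j + 1 = i) (hki : i + 1 = k) (hjl : l + 1 = j) (s : R) :
    (∀ h : (Cone f).homology i, s • h = 0) ↔ ∀ (x : X.X j) (y : Y.X i), X.d j l x = 0 →
      f.f j x + Y.d i j y = 0 → ∃ (x' : X.X i) (y' : Y.X k), - X.d i j x' = s • x ∧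
        f.f i x' + Y.d k i y' = s • y := by
  rw [homology_kill_iff _ i j k hij hki]
  constructor
  · intro h x y hx hy
    obtain ⟨b, hb⟩ := h ((coneEquiv f i j hij).symm (x, y)) (by
      apply (coneEquiv f j l hjl).injective
      rw [coneEquiv_d f i j l hij hjl]
      simp [hx, hy])
    have := coneEquiv_d f k i j hki hij b
    rw [hb] at this
    simp only [map_smul, LinearEquiv.apply_symm_apply] at this
    obtain ⟨h1, h2⟩ := Prod.ext_iff.1 this
    exact ⟨_, _, h1.symm, h2.symm⟩
  · intro h c hc
    have h0 := coneEquiv_d f i j l hij hjl c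
    rw [hc, map_zero] at h0
    obtain ⟨h1, h2⟩ := Prod.ext_iff.1 h0
    simp only [Prod.fst_zero, Prod.snd_zero] at h1 h2
    obtain ⟨x', y', hx, hy⟩ := h _ _ (neg_eq_zero.1 h1.symm) h2.symm
    refine ⟨(coneEquiv f k i hki).symm (x', y'), ?_⟩
    apply (coneEquiv f i j hij).injective
    rw [coneEquiv_d f k i j hki hij]
    simp only [LinearEquiv.apply_symm_apply, hx, hy, map_smul]
    rfl

end kill
section alin
variable {A : Type u} [CommRing A]

/-- The differential as an `A`-linear map. -/
def dA (C : ChainComplex (ModuleCat.{u} A[X]) ℤ) (i j : ℤ) : C.X i →ₗ[A] C.X j :=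
  (C.d i j).hom.restrictScalars A

@[simp] theorem dA_apply (C : ChainComplex (ModuleCat.{u} A[X]) ℤ) (i j : ℤ) (c : C.X i) :
    dA C i j c = C.d i j c := rfl

theorem d_d (C : ChainComplex (ModuleCat.{u} A[X]) ℤ) (i j k : ℤ) (c : C.X i) :
    C.d j k (C.d i j c) = 0 := by
  have := congrArg (fun g => g.hom c) (C.d_comp_d i j k)
  exact this

theorem lowSplit (C : ChainComplex (ModuleCat.{u} A[X]) ℤ)
    (hp : ∀ i, Module.Projective A (C.X i)) (b : ℤ) (hb : ∀ i < b, IsZero (C.X i)) (i k : ℤ)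
    (hik : i + 1 = k)
    (hex : ∀ q ≤ i, IsZero (C.homology q)) :
    ∃ h : C.X i →ₗ[A] C.X k, ∀ c : C.X k, C.d k i (h (C.d k i c)) = C.d k i c := by
  have base : ∀ i k : ℤ, i < b → 
      ∃ h : C.X i →ₗ[A] C.X k, ∀ c : C.X k, C.d k i (h (C.d k i c)) = C.d k i c := by
    intro i k hi
    have := ModuleCat.subsingleton_of_isZero (hb i hi)
    exact ⟨0, fun c => Subsingleton.elim _ _⟩
  rcases lt_or_ge i (b - 1) with hi | hi
  · exact base i k (by omega)
  · induction i, hi using Int.leInduction generalizing k with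
    | base => exact base _ k (by omega)
    | succ j hj ih =>
      obtain ⟨h, hh⟩ := ih (j + 1) rfl (fun q hq => hex q (by omega))
      have hx := (homology_isZero_iff C (j + 1) j k rfl hik).1 (hex _ le_rfl)
      let K := LinearMap.ker (dA C (j + 1) j)
      let e : C.X (j + 1) →ₗ[A] K :=
        (LinearMap.id - h ∘ₗ dA C (j + 1) j).codRestrict K (by
          intro c
          simp [K, hh, map_sub])
      let g : C.X k →ₗ[A] K := (dA C k (j + 1)).codRestrict K (by
          intro c
          simp [K, d_d])
      have hg : Function.Surjective g := by
        rintro ⟨c, hc⟩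
        obtain ⟨b, hb⟩ := hx c (by simpa [K] using hc)
        exact ⟨b, Subtype.ext hb⟩
      have := hp (j + 1)
      obtain ⟨h', hh'⟩ := Module.projective_lifting_property g e hg
      refine ⟨h', fun c => ?_⟩
      have := congrArg Subtype.val (LinearMap.congr_fun hh' (C.d k (j + 1) c))
      have h2 : C.d k (j + 1) (h' (C.d k (j + 1) c)) =
        C.d k (j + 1) c - h (C.d (j + 1) j (C.d k (j + 1) c)) := this
      rw [h2, d_d, map_zero, sub_zero]

theorem homology_fgProj (C : ChainComplex (ModuleCat.{u} A[X]) ℤ) (i j k : ℤ)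
    (hij : j + 1 = i) (hki : i + 1 = k) (hfg : FGProjOverA A (C.X i))
    (h₀ : C.X j →ₗ[A] C.X i) (hh₀ : ∀ c, C.d i j (h₀ (C.d i j c)) = C.d i j c)
    (h₁ : C.X i →ₗ[A] C.X k) (hh₁ : ∀ c, C.d k i (h₁ (C.d k i c)) = C.d k i c) :
    FGProjOverA A (C.homology i) := by
  obtain ⟨hf, hp⟩ := (fgProj_iff _).1 hfg
  obtain ⟨π, hs, hk⟩ := homology_pi C i j k hij hki
  let πA : LinearMap.ker (C.d i j).hom →ₗ[A] C.homology i := π.restrictScalars A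
  let e : C.X i →ₗ[A] C.X i :=
    (LinearMap.id - dA C k i ∘ₗ h₁) ∘ₗ (LinearMap.id - h₀ ∘ₗ dA C i j)
  have he : ∀ c, e c = (c - h₀ (C.d i j c)) - C.d k i (h₁ (c - h₀ (C.d i j c))) := fun c => rfl
  have hde : ∀ c, C.d i j (e c) = 0 := by
    intro c
    rw [he, map_sub, d_d, map_sub, hh₀, sub_self, sub_zero]
  have hed : ∀ c, e (C.d k i c) = 0 := by
    intro c
    rw [he, d_d, map_zero, sub_zero, hh₁, sub_self]
  have hez : ∀ c, C.d i j c = 0 → ∃ b, C.d k i b = c - e c := by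
    intro c hc
    exact ⟨h₁ c, by rw [he, hc, map_zero, sub_zero, sub_sub_cancel]⟩
  let e' : C.X i →ₗ[A] LinearMap.ker (C.d i j).hom :=
    { toFun := fun c => ⟨e c, hde c⟩
      map_add' := fun a b => Subtype.ext (map_add e a b)
      map_smul' := fun a b => Subtype.ext (map_smul e a b) }
  let sub : LinearMap.ker (C.d i j).hom →ₗ[A] C.X i :=
    (LinearMap.ker (C.d i j).hom).subtype.restrictScalars A
  let r : C.X i →ₗ[A] C.homology i := πA ∘ₗ e'
  have hle : LinearMap.ker πA ≤ LinearMap.ker (e ∘ₗ sub) := by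
    intro c hc
    obtain ⟨b, hb⟩ := (hk c).1 hc
    change e c.1 = 0
    rw [← hb, hed]
  let s : C.homology i →ₗ[A] C.X i :=
    (LinearMap.ker πA).liftQ (e ∘ₗ sub) hle ∘ₗ (πA.quotKerEquivOfSurjective hs).symm.toLinearMap
  have hsπ : ∀ c, s (πA c) = e c.1 := by
    intro c
    have : (πA.quotKerEquivOfSurjective hs).symm (πA c) = Submodule.Quotient.mk c := by
      rw [LinearEquiv.symm_apply_eq]; rfl
    change (LinearMap.ker πA).liftQ (e ∘ₗ sub) hle ((πA.quotKerEquivOfSurjective hs).symm (πA c)) = _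
    rw [this]; rfl
  have key : ∀ x, r (s x) = x := by
    intro x
    obtain ⟨c, rfl⟩ := hs x
    have h1 : s (π c) = e c.1 := hsπ c
    rw [h1]
    change π (e' (e c.1)) = π c
    rw [← sub_eq_zero, ← map_sub]
    refine (hk _).2 ?_
    obtain ⟨b1, hb1⟩ := hez c.1 c.2
    obtain ⟨b2, hb2⟩ := hez (e c.1) (hde _)
    refine ⟨- b1 - b2, ?_⟩
    rw [map_sub, map_neg, hb1, hb2]
    change _ = e (e c.1) - c.1
    abel
  refine (fgProj_iff _).2 ⟨Module.Finite.of_surjective r fun x => ⟨s x, key x⟩,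
    Module.Projective.of_split s r (LinearMap.ext key)⟩

end alin
section cellalg
variable {A : Type u} [CommRing A]

theorem exists_monic_kill (M : Type u) [AddCommGroup M] [Module A[X] M] [Module A M]
    [IsScalarTower A A[X] M] [Module.Finite A M] :
    ∃ r : A[X], r.Monic ∧ ∀ x : M, r • x = 0 := by
  let T : Module.End A M := (LinearMap.lsmul A[X] M X).restrictScalars A
  obtain ⟨r, hr, h0⟩ := LinearMap.exists_monic_and_aeval_eq_zero A T
  refine ⟨r, hr, fun x => ?_⟩
  have key : ∀ p : A[X], ∀ x : M, aeval T p x = p • x := by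
    intro p
    induction p using Polynomial.induction_on' with
    | add p q hp hq => intro x; rw [map_add, LinearMap.add_apply, hp, hq, add_smul]
    | monomial n a =>
      intro x
      have hT : ∀ n : ℕ, ∀ x : M, (T ^ n) x = (X ^ n : A[X]) • x := by
        intro n
        induction n with
        | zero => intro x; simp
        | succ n ih =>
          intro x
          rw [pow_succ, Module.End.mul_apply, ih, pow_succ, mul_smul]
          rfl
      rw [aeval_monomial, Module.End.mul_apply, hT, Module.algebraMap_end_apply,
        ← smul_assoc, ← C_mul_X_pow_eq_monomial, smul_eq_C_mul]
  rw [← key, h0, LinearMap.zero_apply]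

/-- multiplication by `s`, `A[X]/(r) → A[X]/(s r)`. -/
def sig (r s : A[X]) : (A[X] ⧸ Ideal.span {r}) →ₗ[A[X]] (A[X] ⧸ Ideal.span {s * r}) :=
  Submodule.mapQ (Ideal.span {r}) (Ideal.span {s * r}) (LinearMap.lsmul A[X] A[X] s) (by
    rw [Ideal.span, Submodule.span_le, Set.singleton_subset_iff]
    exact Ideal.mem_span_singleton_self _)

theorem sig_mk (r s f : A[X]) :
    sig r s (Ideal.Quotient.mk _ f) = Ideal.Quotient.mk _ (s * f) := rfl

theorem sig_inj (r s : A[X]) (hs : s.Monic) : Function.Injective (sig r s) := by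
  rw [injective_iff_map_eq_zero]
  intro x hx
  obtain ⟨f, rfl⟩ := Ideal.Quotient.mk_surjective x
  rw [sig_mk, Ideal.Quotient.eq_zero_iff_mem, Ideal.mem_span_singleton] at hx
  rw [Ideal.Quotient.eq_zero_iff_mem, Ideal.mem_span_singleton]
  obtain ⟨c, hc⟩ := hx
  refine ⟨c, hs.isRegular.left ?_⟩
  simpa [mul_assoc] using hc

theorem sig_retract (r s : A[X]) (hs : s.Monic) :
    ∃ ρ : (A[X] ⧸ Ideal.span {s * r}) →ₗ[A] (A[X] ⧸ Ideal.span {r}), ∀ u, ρ (sig r s u) = u := by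
  have := hs.free_quotient
  let p : (A[X] ⧸ Ideal.span {s * r}) →ₐ[A] (A[X] ⧸ Ideal.span {s}) :=
    Ideal.Quotient.factorₐ A (by
      rw [Ideal.span_singleton_le_span_singleton]; exact Dvd.intro _ rfl)
  have hp : Function.Surjective p := by
    intro x
    obtain ⟨f, rfl⟩ := Ideal.Quotient.mk_surjective x
    exact ⟨Ideal.Quotient.mk _ f, rfl⟩
  obtain ⟨t, ht⟩ := Module.projective_lifting_property p.toLinearMap LinearMap.id hp
  let σ := (sig r s).restrictScalars A
  have hσ : Function.Injective σ := sig_inj r s hs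
  let E := LinearEquiv.ofInjective σ hσ
  let ρ' : (A[X] ⧸ Ideal.span {s * r}) →ₗ[A] LinearMap.range σ :=
    (LinearMap.id - t ∘ₗ p.toLinearMap).codRestrict _ (by
      intro v
      have h1 : p (v - t (p v)) = 0 := by
        rw [map_sub, sub_eq_zero]
        exact (LinearMap.congr_fun ht (p v)).symm
      obtain ⟨f, hf⟩ := Ideal.Quotient.mk_surjective (v - t (p v))
      rw [← hf] at h1
      have h2 : Ideal.Quotient.mk (Ideal.span {s}) f = 0 := h1
      rw [Ideal.Quotient.eq_zero_iff_mem, Ideal.mem_span_singleton] at h2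
      obtain ⟨c, rfl⟩ := h2
      exact ⟨Ideal.Quotient.mk _ c, hf⟩)
  refine ⟨E.symm.toLinearMap ∘ₗ ρ', fun u => ?_⟩
  change E.symm (ρ' (σ u)) = u
  rw [LinearEquiv.symm_apply_eq]
  apply Subtype.ext
  change σ u - t (p (σ u)) = σ u
  have : p (σ u) = 0 := by
    obtain ⟨f, rfl⟩ := Ideal.Quotient.mk_surjective u
    change Ideal.Quotient.mk (Ideal.span {s}) (s * f) = 0
    rw [Ideal.Quotient.eq_zero_iff_mem, Ideal.mem_span_singleton]
    exact Dvd.intro _ rfl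
  rw [this, map_zero, sub_zero]

theorem sig_kill (r s : A[X]) (v : A[X] ⧸ Ideal.span {s * r}) : ∃ u, sig r s u = s • v := by
  obtain ⟨f, rfl⟩ := Ideal.Quotient.mk_surjective v
  exact ⟨Ideal.Quotient.mk _ f, rfl⟩

/-- `A[X]/(r) → M` sending `1` to `x`. -/
def evq {M : Type u} [AddCommGroup M] [Module A[X] M] (r : A[X]) (hr : ∀ x : M, r • x = 0) (x : M) :
    (A[X] ⧸ Ideal.span {r}) →ₗ[A[X]] M :=
  Submodule.liftQ (Ideal.span {r}) (LinearMap.toSpanSingleton A[X] M x) (by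
    rw [Ideal.span, Submodule.span_le, Set.singleton_subset_iff]
    exact hr x)

theorem evq_mk {M : Type u} [AddCommGroup M] [Module A[X] M] (r : A[X])
    (hr : ∀ x : M, r • x = 0) (x : M) (f : A[X]) : evq r hr x (Ideal.Quotient.mk _ f) = f • x := rfl

theorem exists_cell_alg {M N : ModuleCat.{u} A[X]} (d : N ⟶ M) (hM : Module.Finite A M)
    (hN : Module.Finite A N) (K : Submodule A[X] M) (hK : K.FG) (s : A[X]) (hs : s.Monic)
    (hkill : ∀ c ∈ K, ∃ b, d b = s • c) :
    ∃ (U V : ModuleCat.{u} A[X]) (σ : U ⟶ V) (ρ : V →ₗ[A] U) (a : V ⟶ M) (b : U ⟶ N),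
      FGProjOverA A U ∧ FGProjOverA A V ∧ (∀ u, ρ (σ u) = u) ∧ (∀ v, ∃ u, σ u = s • v) ∧
      (∀ v, a v ∈ K) ∧ (∀ c ∈ K, ∃ v, a v = c) ∧ b ≫ d = σ ≫ a := by
  obtain ⟨r₁, hr₁, hk₁⟩ := exists_monic_kill (A := A) M
  obtain ⟨r₂, hr₂, hk₂⟩ := exists_monic_kill (A := A) N
  let r := r₁ * r₂
  have hr : r.Monic := hr₁.mul hr₂
  have hrM : ∀ x : M, (s * r) • x = 0 := fun x => by
    rw [show s * r = (s * r₂) * r₁ by simp only [r]; ring, mul_smul, hk₁, smul_zero]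
  have hrN : ∀ x : N, r • x = 0 := fun x => by
    rw [mul_smul, hk₂, smul_zero]
  obtain ⟨n, g, hg⟩ := Submodule.fg_iff_exists_fin_generating_family.1 hK
  have hgK : ∀ i, g i ∈ K := fun i => hg ▸ Submodule.subset_span ⟨i, rfl⟩
  choose w hw using fun i => hkill (g i) (hgK i)
  have := hr.free_quotient
  have := hr.finite_quotient
  have := (hs.mul hr).free_quotient
  have := (hs.mul hr).finite_quotient
  obtain ⟨U, ⟨eU⟩⟩ : ∃ U : ModuleCat.{u} A[X],
      Nonempty ((Fin n → A[X] ⧸ Ideal.span {r}) ≃ₗ[A[X]] U) :=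
    ⟨ModuleCat.of _ _, ⟨LinearEquiv.refl _ _⟩⟩
  obtain ⟨V, ⟨eV⟩⟩ : ∃ V : ModuleCat.{u} A[X],
      Nonempty ((Fin n → A[X] ⧸ Ideal.span {s * r}) ≃ₗ[A[X]] V) :=
    ⟨ModuleCat.of _ _, ⟨LinearEquiv.refl _ _⟩⟩
  let eU' : (Fin n → A[X] ⧸ Ideal.span {r}) ≃ₗ[A] U := eU.restrictScalars A
  let eV' : (Fin n → A[X] ⧸ Ideal.span {s * r}) ≃ₗ[A] V := eV.restrictScalars A
  obtain ⟨ρ₁, hρ₁⟩ := sig_retract r s hs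
  let σ : (Fin n → A[X] ⧸ Ideal.span {r}) →ₗ[A[X]] (Fin n → A[X] ⧸ Ideal.span {s * r}) :=
    LinearMap.pi fun i => sig r s ∘ₗ LinearMap.proj i
  let ρ : (Fin n → A[X] ⧸ Ideal.span {s * r}) →ₗ[A] (Fin n → A[X] ⧸ Ideal.span {r}) :=
    LinearMap.pi fun i => ρ₁ ∘ₗ LinearMap.proj i
  let a : (Fin n → A[X] ⧸ Ideal.span {s * r}) →ₗ[A[X]] M :=
    ∑ i, evq (s * r) hrM (g i) ∘ₗ LinearMap.proj i
  let b : (Fin n → A[X] ⧸ Ideal.span {r}) →ₗ[A[X]] N :=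
    ∑ i, evq r hrN (w i) ∘ₗ LinearMap.proj i
  have ha : ∀ v, a v = ∑ i, evq (s * r) hrM (g i) (v i) := fun v => by
    simp only [a, LinearMap.sum_apply, LinearMap.comp_apply]; rfl
  have hb : ∀ v, b v = ∑ i, evq r hrN (w i) (v i) := fun v => by
    simp only [b, LinearMap.sum_apply, LinearMap.comp_apply]; rfl
  refine ⟨U, V, ModuleCat.ofHom (eV.toLinearMap ∘ₗ σ ∘ₗ eU.symm.toLinearMap),
    eU'.toLinearMap ∘ₗ ρ ∘ₗ eV'.symm.toLinearMap,
    ModuleCat.ofHom (a ∘ₗ eV.symm.toLinearMap), ModuleCat.ofHom (b ∘ₗ eU.symm.toLinearMap),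
    (fgProj_iff _).2 ⟨Module.Finite.equiv eU', Module.Projective.of_equiv eU'⟩,
    (fgProj_iff _).2 ⟨Module.Finite.equiv eV', Module.Projective.of_equiv eV'⟩, ?_, ?_, ?_, ?_, ?_⟩
  · intro u
    change eU (ρ (eV.symm (eV (σ (eU.symm u))))) = u
    rw [LinearEquiv.symm_apply_apply]
    have : ρ (σ (eU.symm u)) = eU.symm u := funext fun i => hρ₁ _
    rw [this, LinearEquiv.apply_symm_apply]
  · intro v
    choose u hu using fun i => sig_kill r s (eV.symm v i)
    refine ⟨eU u, ?_⟩
    change eV (σ (eU.symm (eU u))) = s • v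
    rw [LinearEquiv.symm_apply_apply]
    have : σ u = s • eV.symm v := funext hu
    rw [this, map_smul, LinearEquiv.apply_symm_apply]
  · intro v
    change a (eV.symm v) ∈ K
    rw [ha]
    refine K.sum_mem fun i _ => ?_
    obtain ⟨f, hf⟩ := Ideal.Quotient.mk_surjective (eV.symm v i)
    rw [← hf, evq_mk]
    exact K.smul_mem _ (hgK i)
  · intro c hc
    rw [← hg, Submodule.mem_span_range_iff_exists_fun] at hc
    obtain ⟨q, rfl⟩ := hc
    refine ⟨eV (fun i => Ideal.Quotient.mk _ (q i)), ?_⟩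
    change a (eV.symm (eV _)) = _
    rw [LinearEquiv.symm_apply_apply]
    exact ha _
  · ext u
    change d (b (eU.symm u)) = a (eV.symm (eV (σ (eU.symm u))))
    rw [LinearEquiv.symm_apply_apply]
    generalize eU.symm u = u
    rw [ha, hb, map_sum]
    refine Finset.sum_congr rfl fun i _ => ?_
    change _ = evq (s * r) hrM (g i) (sig r s (u i))
    obtain ⟨f, hf⟩ := Ideal.Quotient.mk_surjective (u i)
    rw [← hf, sig_mk, evq_mk, evq_mk, map_smul, hw, smul_smul, mul_comm]

theorem fgProj_iso {M N : ModuleCat.{u} A[X]} (e : M ≅ N) (h : FGProjOverA A M) :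
    FGProjOverA A N := by
  obtain ⟨h1, h2⟩ := (fgProj_iff _).1 h
  let E : M ≃ₗ[A] N := e.toLinearEquiv.restrictScalars A
  exact (fgProj_iff _).2 ⟨Module.Finite.equiv E, Module.Projective.of_equiv E⟩

theorem fgProj_zero {M : ModuleCat.{u} A[X]} (e : IsZero M) : FGProjOverA A M := by
  have := ModuleCat.subsingleton_of_isZero e
  exact (fgProj_iff _).2 ⟨inferInstance, inferInstance⟩

theorem exists_cell (C : ChainComplex (ModuleCat.{u} A[X]) ℤ) (j n k : ℤ) (hjn : j + 1 = n)
    (hnk : n + 1 = k) (hM : Module.Finite A (C.X n)) (hN : Module.Finite A (C.X k))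
    (h₀ : C.X j →ₗ[A] C.X n) (hh₀ : ∀ c, C.d n j (h₀ (C.d n j c)) = C.d n j c)
    (s : A[X]) (hs : s.Monic) (hkill : ∀ x : C.homology n, s • x = 0) :
    ∃ (G : ChainComplex (ModuleCat.{u} A[X]) ℤ) (γ : G ⟶ C),
      (∀ i, FGProjOverA A (G.X i)) ∧ (∀ i, i ≠ n → i ≠ k → IsZero (G.X i)) ∧
      (∃ ρ : G.X n →ₗ[A] G.X k, ∀ u, ρ (G.d k n u) = u) ∧
      (∀ v : G.X n, ∃ u, G.d k n u = s • v) ∧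
      (∀ c : C.X n, C.d n j c = 0 → ∃ v : G.X n, γ.f n v = c) := by
  rw [homology_kill_iff C n j k hjn hnk] at hkill
  let K : Submodule A[X] (C.X n) := LinearMap.ker (C.d n j).hom
  let KA : Submodule A (C.X n) := LinearMap.ker (dA C n j)
  have hKA : KA.FG := by
    let e : C.X n →ₗ[A] KA := (LinearMap.id - h₀ ∘ₗ dA C n j).codRestrict KA (by
      intro c
      simp [KA, hh₀, map_sub])
    have : Module.Finite A KA := Module.Finite.of_surjective e (by
      rintro ⟨c, hc⟩
      refine ⟨c, Subtype.ext ?_⟩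
      change c - h₀ (dA C n j c) = c
      rw [LinearMap.mem_ker.1 hc, map_zero, sub_zero])
    exact Module.Finite.iff_fg.1 this
  have hK : K.FG := by
    obtain ⟨t, ht⟩ := hKA
    refine ⟨t, le_antisymm ?_ ?_⟩
    · rw [Submodule.span_le]
      intro x hx
      have : x ∈ KA := ht ▸ Submodule.subset_span hx
      exact this
    · intro x hx
      have h1 : x ∈ KA := hx
      rw [← ht] at h1
      exact Submodule.span_subset_span A A[X] _ h1
  obtain ⟨U, V, σ, ρ, a, b, hU, hV, hρ, hσ, haK, haS, hcomm⟩ :=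
    exists_cell_alg (C.d k n) hM hN K hK s hs (fun c hc => hkill c hc)
  have hne : k ≠ n := by omega
  have hrel : (ComplexShape.down ℤ).Rel k n := hnk
  let G := HomologicalComplex.double σ hrel
  let e₀ : G.X k ≅ U := HomologicalComplex.doubleXIso₀ σ hrel
  let e₁ : G.X n ≅ V := HomologicalComplex.doubleXIso₁ σ hrel hne
  have hd : G.d k n = e₀.hom ≫ σ ≫ e₁.inv := HomologicalComplex.double_d σ hrel hne
  have hz : ∀ i, i ≠ n → i ≠ k → IsZero (G.X i) := fun i h1 h2 =>
    HomologicalComplex.isZero_double_X σ hrel i h2 h1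
  let γ : G ⟶ C := HomologicalComplex.mkHomFromDouble hrel hne b a hcomm (by
    intro l hl
    have : l = j := by have : l + 1 = n := hl; omega
    subst this
    ext v
    exact haK v)
  have hγ : γ.f n = e₁.hom ≫ a := HomologicalComplex.mkHomFromDouble_f₁ hrel hne b a hcomm _
  have hdu : ∀ u : U, G.d k n (e₀.inv u) = e₁.inv (σ u) := by
    intro u
    rw [hd]; simp
  refine ⟨G, γ, ?_, hz, ?_, ?_, ?_⟩
  · intro i
    by_cases h1 : i = n
    · subst h1; exact fgProj_iso e₁.symm hV
    · by_cases h2 : i = k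
      · subst h2; exact fgProj_iso e₀.symm hU
      · exact fgProj_zero (hz i h1 h2)
  · refine ⟨e₀.inv.hom.restrictScalars A ∘ₗ ρ ∘ₗ e₁.hom.hom.restrictScalars A, fun u => ?_⟩
    change e₀.inv (ρ (e₁.hom (G.d k n u))) = u
    rw [hd]
    simp [hρ]
  · intro v
    obtain ⟨u, hu⟩ := hσ (e₁.hom v)
    refine ⟨e₀.inv u, ?_⟩
    rw [hdu, hu, map_smul]
    simp
  · intro c hc
    obtain ⟨v, hv⟩ := haS c hc
    refine ⟨e₁.inv v, ?_⟩
    rw [hγ]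
    simp [hv]

end cellalg
section twist
variable {R : Type u} [CommRing R]

theorem isZero_iff_kill_one (M : ModuleCat.{u} R) : IsZero M ↔ ∀ x : M, (1 : R) • x = 0 := by
  constructor
  · intro h x
    have := ModuleCat.subsingleton_of_isZero h
    exact Subsingleton.elim _ _
  · intro h
    have : Subsingleton M := subsingleton_of_forall_eq 0 fun x => by rw [← h x, one_smul]
    exact ModuleCat.isZero_of_subsingleton _

theorem dd (C : ChainComplex (ModuleCat.{u} R) ℤ) (i j k : ℤ) (c : C.X i) :
    C.d j k (C.d i j c) = 0 := by
  have := congrArg (fun g => g.hom c) (C.d_comp_d i j k)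
  exact this

theorem comm_apply {C D : ChainComplex (ModuleCat.{u} R) ℤ} (γ : C ⟶ D) (i j : ℤ) (c : C.X i) :
    γ.f j (C.d i j c) = D.d i j (γ.f i c) := by
  have := congrArg (fun g => g.hom c) (γ.comm i j)
  exact this.symm

variable {X Y G : ChainComplex (ModuleCat.{u} R) ℤ} {f : X ⟶ Y} (γ : G ⟶ Cone f)

/-- First component of `γ`. -/
def alp (i j : ℤ) (hij : j + 1 = i) : G.X i →ₗ[R] X.X j :=
  LinearMap.fst R _ _ ∘ₗ (coneEquiv f i j hij).toLinearMap ∘ₗ (γ.f i).hom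

/-- Second component of `γ`. -/
def bet (i : ℤ) : G.X i →ₗ[R] Y.X i :=
  LinearMap.snd R _ _ ∘ₗ (coneEquiv f i (i - 1) (by omega)).toLinearMap ∘ₗ (γ.f i).hom

theorem coneEquiv_gam (i j : ℤ) (hij : j + 1 = i) (g : G.X i) :
    coneEquiv f i j hij (γ.f i g) = (alp γ i j hij g, bet γ i g) := by
  obtain rfl : j = i - 1 := by omega
  rfl

theorem alp_d (i j l : ℤ) (hij : j + 1 = i) (hjl : l + 1 = j) (g : G.X i) :
    alp γ j l hjl (G.d i j g) = - X.d j l (alp γ i j hij g) := by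
  have h := coneEquiv_d f i j l hij hjl (γ.f i g)
  rw [← comm_apply, coneEquiv_gam, coneEquiv_gam] at h
  exact congrArg Prod.fst h

theorem bet_d (i j : ℤ) (hij : j + 1 = i) (g : G.X i) :
    bet γ j (G.d i j g) = f.f j (alp γ i j hij g) + Y.d i j (bet γ i g) := by
  have h := coneEquiv_d f i j (j - 1) hij (by omega) (γ.f i g)
  rw [← comm_apply, coneEquiv_gam, coneEquiv_gam] at h
  exact congrArg Prod.snd h

/-- Differential of the twisted sum. -/
def twd (i j : ℤ) (hij : j + 1 = i) : (X.X i × G.X i) →ₗ[R] (X.X j × G.X j) :=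
  LinearMap.prod ((X.d i j).hom ∘ₗ LinearMap.fst R _ _ - alp γ i j hij ∘ₗ LinearMap.snd R _ _)
    ((G.d i j).hom ∘ₗ LinearMap.snd R _ _)

theorem twd_apply (i j : ℤ) (hij : j + 1 = i) (x : X.X i) (g : G.X i) :
    twd γ i j hij (x, g) = (X.d i j x - alp γ i j hij g, G.d i j g) := rfl

/-- Twisted sum. -/
def tw : ChainComplex (ModuleCat.{u} R) ℤ where
  X i := ModuleCat.of R (X.X i × G.X i)
  d i j := if hij : j + 1 = i then ModuleCat.ofHom (twd γ i j hij) else 0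
  shape i j h := dif_neg h
  d_comp_d' i j k hij hjk := by
    have hij' : j + 1 = i := hij
    have hjk' : k + 1 = j := hjk
    rw [dif_pos hij', dif_pos hjk']
    apply ModuleCat.hom_ext
    apply LinearMap.ext
    rintro ⟨x, g⟩
    change twd γ j k hjk' (twd γ i j hij' (x, g)) = 0
    rw [twd_apply, twd_apply, map_sub, dd, dd, alp_d γ i j k hij' hjk']
    simp

/-- Data of the twisted sum. -/
structure Twist where
  /-- complex -/
  Z : ChainComplex (ModuleCat.{u} R) ℤ
  /-- identification -/
  e : ∀ i, Z.X i ≃ₗ[R] X.X i × G.X i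
  /-- inclusion -/
  ι : X ⟶ Z
  /-- map to `Y` -/
  f' : Z ⟶ Y
  fac : ι ≫ f' = f
  e_ι : ∀ i x, e i (ι.f i x) = (x, 0)
  e_d : ∀ i j (hij : j + 1 = i) z, e j (Z.d i j z) =
    (X.d i j (e i z).1 - alp γ i j hij (e i z).2, G.d i j (e i z).2)
  f'_apply : ∀ i z, f'.f i z = f.f i (e i z).1 + bet γ i (e i z).2

theorem tw_d (i j : ℤ) (hij : j + 1 = i) : (tw γ).d i j = ModuleCat.ofHom (twd γ i j hij) :=
  dif_pos hij

theorem exists_twist : Nonempty (Twist γ) := by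
  let ι : X ⟶ tw γ :=
    { f := fun i => ModuleCat.ofHom (LinearMap.inl R (X.X i) (G.X i))
      comm' := by
        intro i j hij₀
        have hij : j + 1 = i := hij₀
        rw [tw_d γ i j hij]
        apply ModuleCat.hom_ext
        apply LinearMap.ext
        intro x
        change twd γ i j hij (x, 0) = (X.d i j x, 0)
        rw [twd_apply]
        simp }
  let f' : tw γ ⟶ Y :=
    { f := fun i => ModuleCat.ofHom (LinearMap.coprod (f.f i).hom (bet γ i))
      comm' := by
        intro i j hij₀
        have hij : j + 1 = i := hij₀
        rw [tw_d γ i j hij]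
        apply ModuleCat.hom_ext
        apply LinearMap.ext
        rintro ⟨x, g⟩
        change Y.d i j (f.f i x + bet γ i g) =
          f.f j (X.d i j x - alp γ i j hij g) + bet γ j (G.d i j g)
        rw [bet_d γ i j hij, map_add, map_sub, comm_apply]
        abel }
  exact ⟨{
    Z := tw γ
    e := fun i => LinearEquiv.refl _ _
    ι := ι
    f' := f'
    fac := by
      ext i x
      change f.f i x + bet γ i 0 = f.f i x
      rw [map_zero, add_zero]
    e_ι := fun i x => rfl
    e_d := fun i j hij z => by
      rw [tw_d γ i j hij]
      rfl
    f'_apply := fun i z => rfl }⟩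

variable {γ} (T : Twist γ)

/-- Swap. -/
def swapEq (M N P : Type u) [AddCommGroup M] [Module R M] [AddCommGroup N] [Module R N]
    [AddCommGroup P] [Module R P] : ((M × N) × P) ≃ₗ[R] ((M × P) × N) where
  toFun a := ((a.1.1, a.2), a.1.2)
  invFun a := ((a.1.1, a.2), a.1.2)
  map_add' _ _ := rfl
  map_smul' _ _ := rfl
  left_inv _ := rfl
  right_inv _ := rfl

theorem iota_kill (i j k l : ℤ) (hij : j + 1 = i) (hki : i + 1 = k) (hjl : l + 1 = j) (s : R)
    (hG : ∀ g : G.X i, G.d i j g = 0 → ∃ g', G.d k i g' = s • g) :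
    ∀ h : (Cone T.ι).homology i, s • h = 0 := by
  rw [cone_kill_iff T.ι i j k l hij hki hjl]
  intro x' z hx' hz
  have hz' := congrArg (T.e j) hz
  rw [map_add, T.e_ι, T.e_d i j hij, map_zero] at hz'
  obtain ⟨h1, h2⟩ := Prod.ext_iff.1 hz'
  simp only [Prod.fst_add, Prod.snd_add, Prod.fst_zero, Prod.snd_zero, zero_add] at h1 h2
  obtain ⟨g', hg'⟩ := hG _ h2
  refine ⟨s • (T.e i z).1 + alp γ k i hki g', (T.e k).symm (0, g'), ?_, ?_⟩
  · have := alp_d γ k i j hki hij g'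
    rw [map_add, map_smul, ← neg_eq_iff_eq_neg.2 this, hg', map_smul, eq_neg_of_add_eq_zero_left h1,
      smul_neg, smul_sub]
    abel
  · apply (T.e i).injective
    rw [map_add, T.e_ι, T.e_d k i hki, LinearEquiv.apply_symm_apply, map_smul, map_zero, hg']
    apply Prod.ext
    · simp
    · simp

/-- The cone of the second map as the cone of `γ`. -/
def coneTw (i j : ℤ) (hij : j + 1 = i) : (Cone T.f').X i ≃ₗ[R] (Cone f).X i × G.X j :=
  (coneEquiv T.f' i j hij).trans
    (((T.e j).prodCongr (LinearEquiv.refl R (Y.X i))).trans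
      ((swapEq _ _ _).trans ((coneEquiv f i j hij).symm.prodCongr (LinearEquiv.refl R (G.X j)))))

theorem coneTw_apply (j l : ℤ) (hjl : l + 1 = j) (w : (Cone T.f').X j) : coneTw T j l hjl w =
    ((coneEquiv f j l hjl).symm ((T.e l (coneEquiv T.f' j l hjl w).1).1,
      (coneEquiv T.f' j l hjl w).2), (T.e l (coneEquiv T.f' j l hjl w).1).2) := rfl

theorem coneTw_d (i j l : ℤ) (hij : j + 1 = i) (hjl : l + 1 = j) (c : (Cone T.f').X i) :
    coneTw T j l hjl ((Cone T.f').d i j c) =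
      ((Cone f).d i j (coneTw T i j hij c).1 + γ.f j (coneTw T i j hij c).2,
        - G.d j l (coneTw T i j hij c).2) := by
  obtain ⟨⟨z, y⟩, rfl⟩ := (coneEquiv T.f' i j hij).symm.surjective c
  have h1 : coneTw T i j hij ((coneEquiv T.f' i j hij).symm (z, y)) =
      ((coneEquiv f i j hij).symm ((T.e j z).1, y), (T.e j z).2) := by
    rw [coneTw_apply, LinearEquiv.apply_symm_apply]
  rw [h1]
  have h2 := coneEquiv_d T.f' i j l hij hjl ((coneEquiv T.f' i j hij).symm (z, y))
  rw [LinearEquiv.apply_symm_apply] at h2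
  rw [coneTw_apply, h2]
  apply Prod.ext
  · apply (coneEquiv f j l hjl).injective
    change coneEquiv f j l hjl ((coneEquiv f j l hjl).symm _) = coneEquiv f j l hjl (_ + _)
    rw [LinearEquiv.apply_symm_apply, map_add, coneEquiv_d f i j l hij hjl,
      LinearEquiv.apply_symm_apply, coneEquiv_gam]
    apply Prod.ext
    · change (T.e l (- T.Z.d j l z)).1 = - X.d j l (T.e j z).1 + alp γ j l hjl (T.e j z).2
      rw [map_neg, T.e_d j l hjl]
      change -(_ - _) = _
      abel
    · change T.f'.f j z + Y.d i j y = (f.f j (T.e j z).1 + Y.d i j y) + bet γ j (T.e j z).2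
      rw [T.f'_apply]
      abel
  · change (T.e l (- T.Z.d j l z)).2 = - G.d j l (T.e j z).2
    rw [map_neg, T.e_d j l hjl]
    rfl

theorem coneTw_kill_iff (i j k l : ℤ) (hij : j + 1 = i) (hki : i + 1 = k) (hjl : l + 1 = j) (s : R) :
    (∀ h : (Cone T.f').homology i, s • h = 0) ↔ ∀ (c : (Cone f).X i) (g : G.X j),
      (Cone f).d i j c + γ.f j g = 0 → G.d j l g = 0 → ∃ c' g',
        (Cone f).d k i c' + γ.f i g' = s • c ∧ - G.d i j g' = s • g := by
  rw [homology_kill_iff _ i j k hij hki]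
  constructor
  · intro h x y hx hy
    obtain ⟨b, hb⟩ := h ((coneTw T i j hij).symm (x, y)) (by
      apply (coneTw T j l hjl).injective
      rw [coneTw_d T i j l hij hjl]
      simp [hx, hy])
    have := coneTw_d T k i j hki hij b
    rw [hb] at this
    simp only [map_smul, LinearEquiv.apply_symm_apply] at this
    obtain ⟨h1, h2⟩ := Prod.ext_iff.1 this
    exact ⟨_, _, h1.symm, h2.symm⟩
  · intro h c hc
    have h0 := coneTw_d T i j l hij hjl c
    rw [hc, map_zero] at h0
    obtain ⟨h1, h2⟩ := Prod.ext_iff.1 h0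
    simp only [Prod.fst_zero, Prod.snd_zero] at h1 h2
    obtain ⟨x', y', hx, hy⟩ := h _ _ h1.symm (neg_eq_zero.1 h2.symm)
    refine ⟨(coneTw T k i hki).symm (x', y'), ?_⟩
    apply (coneTw T i j hij).injective
    rw [coneTw_d T k i j hki hij]
    simp only [LinearEquiv.apply_symm_apply, hx, hy, map_smul]
    rfl

theorem coneTw_kill (i j k l : ℤ) (hij : j + 1 = i) (hki : i + 1 = k) (hjl : l + 1 = j) (s t : R)
    (hG : ∀ g : G.X j, G.d j l g = 0 → ∃ g', G.d i j g' = s • g)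
    (hC : ∀ h : (Cone f).homology i, t • h = 0) :
    ∀ h : (Cone T.f').homology i, (t * s) • h = 0 := by
  rw [homology_kill_iff _ i j k hij hki] at hC
  rw [coneTw_kill_iff T i j k l hij hki hjl]
  intro c g hc hg
  obtain ⟨g1, hg1⟩ := hG g hg
  obtain ⟨c1, hc1⟩ := hC (s • c + γ.f i g1) (by
    rw [map_add, map_smul, ← comm_apply, hg1, map_smul, ← smul_add, hc, smul_zero])
  refine ⟨c1, - (t • g1), ?_, ?_⟩
  · rw [hc1, map_neg, map_smul, smul_add, mul_smul]
    abel
  · rw [map_neg, map_smul, hg1, mul_smul, neg_neg]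

theorem coneTw_bot (n j k l : ℤ) (hij : j + 1 = n) (hki : n + 1 = k) (hjl : l + 1 = j)
    (hG : IsZero (G.X j))
    (hs : ∀ c, (Cone f).d n j c = 0 → ∃ v : G.X n, γ.f n v = c) :
    IsZero ((Cone T.f').homology n) := by
  have := ModuleCat.subsingleton_of_isZero hG
  rw [isZero_iff_kill_one, coneTw_kill_iff T n j k l hij hki hjl]
  intro c g hc hg
  obtain rfl : g = 0 := Subsingleton.elim _ _
  rw [map_zero, add_zero] at hc
  obtain ⟨v, hv⟩ := hs c hc
  exact ⟨0, v, by rw [map_zero, zero_add, hv, one_smul], Subsingleton.elim _ _⟩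

end twist

section split
variable {A : Type u} [CommRing A]
variable {X Y G : ChainComplex (ModuleCat.{u} A[X]) ℤ} {f : X ⟶ Y} {γ : G ⟶ Cone f}
  (T : Twist γ)

/-- `A`-linear versions. -/
def alpA (γ : G ⟶ Cone f) (i j : ℤ) (hij : j + 1 = i) : G.X i →ₗ[A] X.X j :=
  (alp γ i j hij).restrictScalars A

theorem iota_split (n j k : ℤ) (hij : j + 1 = n) (hki : n + 1 = k)
    (ρ : G.X n →ₗ[A] G.X k) (hρ : ∀ u, ρ (G.d k n u) = u) :
    ∃ h : (Cone T.ι).X n →ₗ[A] (Cone T.ι).X k,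
      ∀ c, (Cone T.ι).d k n (h ((Cone T.ι).d k n c)) = (Cone T.ι).d k n c := by
  let E₁ : (Cone T.ι).X n →ₗ[A] T.Z.X n :=
    (LinearMap.snd A[X] _ _ ∘ₗ (coneEquiv T.ι n j hij).toLinearMap).restrictScalars A
  let p : T.Z.X n →ₗ[A] X.X n :=
    (LinearMap.fst A[X] _ _ ∘ₗ (T.e n).toLinearMap).restrictScalars A
  let q : T.Z.X n →ₗ[A] G.X n :=
    (LinearMap.snd A[X] _ _ ∘ₗ (T.e n).toLinearMap).restrictScalars A
  let a : X.X n →ₗ[A] (Cone T.ι).X k :=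
    ((coneEquiv T.ι k n hki).symm.toLinearMap ∘ₗ LinearMap.inl A[X] _ _).restrictScalars A
  let b : G.X k →ₗ[A] (Cone T.ι).X k :=
    ((coneEquiv T.ι k n hki).symm.toLinearMap ∘ₗ LinearMap.inr A[X] _ _ ∘ₗ
      (T.e k).symm.toLinearMap ∘ₗ LinearMap.inr A[X] _ _).restrictScalars A
  let h : (Cone T.ι).X n →ₗ[A] (Cone T.ι).X k :=
    (a ∘ₗ (p + alpA γ k n hki ∘ₗ ρ ∘ₗ q) + b ∘ₗ ρ ∘ₗ q) ∘ₗ E₁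
  have hh : ∀ c z, (coneEquiv T.ι n j hij c).2 = z → coneEquiv T.ι k n hki (h c) =
      ((T.e n z).1 + alp γ k n hki (ρ (T.e n z).2), (T.e k).symm (0, ρ (T.e n z).2)) := by
    rintro c _ rfl
    generalize hz : (coneEquiv T.ι n j hij c).2 = z
    have : h c = (coneEquiv T.ι k n hki).symm ((T.e n z).1 + alp γ k n hki (ρ (T.e n z).2), 0) +
      (coneEquiv T.ι k n hki).symm (0, (T.e k).symm (0, ρ (T.e n z).2)) := by
      rw [← hz]; rfl
    rw [this, map_add, LinearEquiv.apply_symm_apply, LinearEquiv.apply_symm_apply]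
    simp
  refine ⟨h, fun c => ?_⟩
  have hd := coneEquiv_d T.ι k n j hki hij c
  generalize coneEquiv T.ι k n hki c = w at hd
  obtain ⟨x', z⟩ := w
  have hez : T.e n (T.ι.f n x' + T.Z.d k n z) =
      (x' + (X.d k n (T.e k z).1 - alp γ k n hki (T.e k z).2), G.d k n (T.e k z).2) := by
    rw [map_add, T.e_ι, T.e_d k n hki]
    simp
  have h1 := hh _ _ (congrArg Prod.snd hd)
  simp only at h1
  rw [hez] at h1
  simp only [hρ] at h1
  apply (coneEquiv T.ι n j hij).injective
  rw [coneEquiv_d T.ι k n j hki hij, h1, hd]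
  have hα := alp_d γ k n j hki hij (T.e k z).2
  apply Prod.ext
  · simp only [map_add, map_sub, dd]
    abel
  · apply (T.e n).injective
    simp only
    rw [hez, map_add, T.e_ι, T.e_d k n hki, LinearEquiv.apply_symm_apply]
    simp only [map_zero, zero_sub]
    apply Prod.ext
    · simp only [Prod.fst_add]
      abel
    · simp

theorem coneTw_split (d j k : ℤ) (hij : j + 1 = d) (hki : d + 1 = k)
    (ρ : G.X j →ₗ[A] G.X d) (hρ : ∀ u, ρ (G.d d j u) = u)
    (h : (Cone f).X d →ₗ[A] (Cone f).X k)
    (hh : ∀ c, (Cone f).d k d (h ((Cone f).d k d c)) = (Cone f).d k d c) :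
    ∃ h : (Cone T.f').X d →ₗ[A] (Cone T.f').X k,
      ∀ c, (Cone T.f').d k d (h ((Cone T.f').d k d c)) = (Cone T.f').d k d c := by
  let p : (Cone T.f').X d →ₗ[A] (Cone f).X d :=
    (LinearMap.fst A[X] _ _ ∘ₗ (coneTw T d j hij).toLinearMap).restrictScalars A
  let q : (Cone T.f').X d →ₗ[A] G.X j :=
    (LinearMap.snd A[X] _ _ ∘ₗ (coneTw T d j hij).toLinearMap).restrictScalars A
  let a : (Cone f).X k →ₗ[A] (Cone T.f').X k :=
    ((coneTw T k d hki).symm.toLinearMap ∘ₗ LinearMap.inl A[X] _ _).restrictScalars A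
  let b : G.X d →ₗ[A] (Cone T.f').X k :=
    ((coneTw T k d hki).symm.toLinearMap ∘ₗ LinearMap.inr A[X] _ _).restrictScalars A
  let γA : G.X d →ₗ[A] (Cone f).X d := (γ.f d).hom.restrictScalars A
  let h' : (Cone T.f').X d →ₗ[A] (Cone T.f').X k :=
    a ∘ₗ h ∘ₗ (p + γA ∘ₗ ρ ∘ₗ q) - b ∘ₗ ρ ∘ₗ q
  have hh' : ∀ w c g, coneTw T d j hij w = (c, g) → coneTw T k d hki (h' w) =
      (h (c + γ.f d (ρ g)), - ρ g) := by
    intro w c g hw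
    have : h' w = (coneTw T k d hki).symm (h ((coneTw T d j hij w).1 +
        γ.f d (ρ (coneTw T d j hij w).2)), 0) -
      (coneTw T k d hki).symm (0, ρ (coneTw T d j hij w).2) := rfl
    rw [this, hw, map_sub, LinearEquiv.apply_symm_apply, LinearEquiv.apply_symm_apply]
    simp
  refine ⟨h', fun w => ?_⟩
  have hd := coneTw_d T k d j hki hij w
  generalize coneTw T k d hki w = u at hd
  obtain ⟨c, g⟩ := u
  have h1 := hh' _ _ _ hd
  simp only [map_neg, hρ, neg_neg, add_neg_cancel_right] at h1
  apply (coneTw T d j hij).injective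
  rw [coneTw_d T k d j hki hij, h1, hd]
  simp only [hh]

end split
section main
variable {A : Type u} [CommRing A]

theorem fgProj_prod {M N P : ModuleCat.{u} A[X]} (e : P ≃ₗ[A[X]] M × N) (hM : FGProjOverA A M)
    (hN : FGProjOverA A N) : FGProjOverA A P := by
  obtain ⟨h1, h2⟩ := (fgProj_iff _).1 hM
  obtain ⟨h3, h4⟩ := (fgProj_iff _).1 hN
  let E : P ≃ₗ[A] M × N := e.restrictScalars A
  exact (fgProj_iff _).2 ⟨Module.Finite.equiv E.symm, Module.Projective.of_equiv E.symm⟩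

theorem isZero_prod {R : Type u} [CommRing R] {M N P : ModuleCat.{u} R} (e : P ≃ₗ[R] M × N)
    (hM : IsZero M) (hN : IsZero N) : IsZero P := by
  have := ModuleCat.subsingleton_of_isZero hM
  have := ModuleCat.subsingleton_of_isZero hN
  have : Subsingleton P := e.toEquiv.subsingleton
  exact ModuleCat.isZero_of_subsingleton _

theorem cone_fg {X Y : ChainComplex (ModuleCat.{u} A[X]) ℤ} (f : X ⟶ Y)
    (hX : ∀ i, FGProjOverA A (X.X i)) (hY : ∀ i, FGProjOverA A (Y.X i)) (i : ℤ) :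
    FGProjOverA A ((Cone f).X i) :=
  fgProj_prod (coneEquiv f i (i - 1) (by omega)) (hX _) (hY _)

theorem cone_zero {X Y : ChainComplex (ModuleCat.{u} A[X]) ℤ} (f : X ⟶ Y) (i : ℤ)
    (hX : IsZero (X.X (i - 1))) (hY : IsZero (Y.X i)) : IsZero ((Cone f).X i) :=
  isZero_prod (coneEquiv f i (i - 1) (by omega)) hX hY

theorem cone_bdd {X Y : ChainComplex (ModuleCat.{u} A[X]) ℤ} (f : X ⟶ Y)
    (hX : ∃ b : ℤ, ∀ i < b, IsZero (X.X i)) (hY : ∃ b : ℤ, ∀ i < b, IsZero (Y.X i)) :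
    ∃ b : ℤ, ∀ i < b, IsZero ((Cone f).X i) := by
  obtain ⟨b, hb⟩ := hX
  obtain ⟨b', hb'⟩ := hY
  exact ⟨min b b', fun i hi => cone_zero f i (hb _ (by omega)) (hb' _ (by omega))⟩

/-- The conclusion of the theorem. -/
def Concl (S : Submonoid A[X]) (X Y : ChainComplex (ModuleCat.{u} A[X]) ℤ) (m : ℤ) (f : X ⟶ Y) :
    Prop :=
    ∃ (N : ℕ) (Z : ℕ → ChainComplex (ModuleCat.{u} (Polynomial A)) ℤ) (hZ0 : Z 0 = X)
      (φ : ∀ j, Z j ⟶ Z (j + 1)) (g : Z N ⟶ Y),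
      (∀ j i, FGProjOverA A ((Z j).X i)) ∧
      QuasiIso g ∧
      eqToHom hZ0.symm ≫ compChain Z φ N ≫ g = f ∧
      ∀ j : ℕ, j < N →
        (∀ q : ℤ, q ≠ m + (j : ℤ) + 1 → IsZero ((Cone (φ j)).homology q)) ∧
        FGProjOverA A ((Cone (φ j)).homology (m + (j : ℤ) + 1)) ∧
        ∃ p ∈ S, ∀ x : (Cone (φ j)).homology (m + (j : ℤ) + 1), p • x = 0

theorem concl_refl (S : Submonoid A[X]) (Y : ChainComplex (ModuleCat.{u} A[X]) ℤ) (m : ℤ)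
    (hY : ∀ i, FGProjOverA A (Y.X i)) : Concl S Y Y m (𝟙 Y) := by
  refine ⟨0, fun _ => Y, rfl, fun _ => 𝟙 Y, 𝟙 Y, fun _ => hY, inferInstance, ?_, ?_⟩
  · simp [compChain]
  · intro j hj
    omega

/-- Prepend a complex. -/
def consZ (X : ChainComplex (ModuleCat.{u} A[X]) ℤ)
    (Z : ℕ → ChainComplex (ModuleCat.{u} A[X]) ℤ) : ℕ → ChainComplex (ModuleCat.{u} A[X]) ℤ
  | 0 => X
  | j + 1 => Z j

/-- Prepend a map. -/
def consφ {X : ChainComplex (ModuleCat.{u} A[X]) ℤ}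
    {Z : ℕ → ChainComplex (ModuleCat.{u} A[X]) ℤ} (ι : X ⟶ Z 0) (φ : ∀ j, Z j ⟶ Z (j + 1)) :
    ∀ j, consZ X Z j ⟶ consZ X Z (j + 1)
  | 0 => ι
  | j + 1 => φ j

theorem compChain_cons {X : ChainComplex (ModuleCat.{u} A[X]) ℤ}
    {Z : ℕ → ChainComplex (ModuleCat.{u} A[X]) ℤ} (ι : X ⟶ Z 0) (φ : ∀ j, Z j ⟶ Z (j + 1)) (N : ℕ) :
    compChain (consZ X Z) (consφ ι φ) (N + 1) = ι ≫ compChain Z φ N := by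
  induction N with
  | zero =>
    change 𝟙 X ≫ ι = ι ≫ 𝟙 _
    rw [Category.id_comp, Category.comp_id]
  | succ N ih =>
    change compChain (consZ X Z) (consφ ι φ) (N + 1) ≫ φ N = ι ≫ (compChain Z φ N ≫ φ N)
    rw [ih]
    exact Category.assoc _ _ _

theorem cp_cast (S : Submonoid A[X]) {X W : ChainComplex (ModuleCat.{u} A[X]) ℤ} (ι : X ⟶ W)
    (a b : ℤ) (hab : a = b)
    (h : (∀ q : ℤ, q ≠ a → IsZero ((Cone ι).homology q)) ∧ FGProjOverA A ((Cone ι).homology a) ∧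
      ∃ p ∈ S, ∀ x : (Cone ι).homology a, p • x = 0) :
    (∀ q : ℤ, q ≠ b → IsZero ((Cone ι).homology q)) ∧ FGProjOverA A ((Cone ι).homology b) ∧
      ∃ p ∈ S, ∀ x : (Cone ι).homology b, p • x = 0 := by
  subst hab
  exact h

theorem concl_cons (S : Submonoid A[X]) {X W Y : ChainComplex (ModuleCat.{u} A[X]) ℤ} (m : ℤ)
    (f : X ⟶ Y) (ι : X ⟶ W) (f' : W ⟶ Y) (hf : ι ≫ f' = f)
    (hX : ∀ i, FGProjOverA A (X.X i))
    (h1 : ∀ q : ℤ, q ≠ m + 1 → IsZero ((Cone ι).homology q))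
    (h2 : FGProjOverA A ((Cone ι).homology (m + 1)))
    (h3 : ∃ p ∈ S, ∀ x : (Cone ι).homology (m + 1), p • x = 0)
    (h : Concl S W Y (m + 1) f') : Concl S X Y m f := by
  obtain ⟨N, Z, rfl, φ, g, hfg, hq, hcomp, hcone⟩ := h
  refine ⟨N + 1, consZ X Z, rfl, consφ ι φ, g, ?_, hq, ?_, ?_⟩
  · intro j i
    cases j with
    | zero => exact hX i
    | succ j => exact hfg j i
  · rw [compChain_cons, ← hf, ← hcomp]
    change 𝟙 X ≫ (ι ≫ compChain Z φ N) ≫ g = ι ≫ 𝟙 _ ≫ compChain Z φ N ≫ g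
    rw [Category.id_comp, Category.id_comp, Category.assoc]
  · intro j hj
    cases j with
    | zero =>
      have e : m + ((0 : ℕ) : ℤ) + 1 = m + 1 := by simp
      exact cp_cast S ι _ _ e.symm ⟨h1, h2, h3⟩
    | succ j =>
      have e : m + ((j + 1 : ℕ) : ℤ) + 1 = m + 1 + (j : ℤ) + 1 := by push_cast; ring
      exact cp_cast S (φ j) _ _ e.symm (hcone j (by omega))

theorem main (S : Submonoid A[X]) (hS : ∀ p ∈ S, p.Monic)
    (Y : ChainComplex (ModuleCat.{u} A[X]) ℤ) (hYb : ∃ b : ℤ, ∀ i < b, IsZero (Y.X i))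
    (hY : ∀ i, FGProjOverA A (Y.X i)) (k : ℕ) :
    ∀ (X : ChainComplex (ModuleCat.{u} A[X]) ℤ) (_ : ∃ b : ℤ, ∀ i < b, IsZero (X.X i))
      (_ : ∀ i, FGProjOverA A (X.X i)) (f : X ⟶ Y) (m d : ℤ) (_ : d = m + 1 + k)
      (_ : ∀ q ≤ m, IsZero ((Cone f).homology q))
      (_ : ∃ s ∈ S, ∀ q, ∀ x : (Cone f).homology q, s • x = 0)
      (_ : ∀ q, d < q → IsZero ((Cone f).homology q))
      (_ : ∃ h : (Cone f).X d →ₗ[A] (Cone f).X (d + 1), ∀ c,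
        (Cone f).d (d + 1) d (h ((Cone f).d (d + 1) d c)) = (Cone f).d (d + 1) d c),
      Concl S X Y m f := by
  induction k with
  | zero =>
    intro X hXb hX f m d hd hlow hkill hhigh hsplit
    obtain rfl : d = m + 1 := by simpa using hd
    obtain ⟨s, hs, hk⟩ := hkill
    obtain ⟨b, hb⟩ := cone_bdd f hXb hYb
    obtain ⟨h₀, hh₀⟩ := lowSplit (Cone f) (fun i => ((fgProj_iff _).1 (cone_fg f hX hY i)).2) b hb
      m (m + 1) rfl hlow
    obtain ⟨h₁, hh₁⟩ := hsplit
    refine concl_cons S m f f (𝟙 Y) (Category.comp_id _) hX ?_ ?_ ⟨s, hs, hk _⟩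
      (concl_refl S Y _ hY)
    · intro q hq
      rcases lt_or_gt_of_ne hq with h | h
      · exact hlow q (by omega)
      · exact hhigh q h
    · exact homology_fgProj (Cone f) (m + 1) m (m + 1 + 1) rfl rfl (cone_fg f hX hY _)
        h₀ hh₀ h₁ hh₁
  | succ k ih =>
    intro X hXb hX f m d hd hlow hkill hhigh hsplit
    obtain ⟨s, hs, hk⟩ := hkill
    obtain ⟨b, hb⟩ := cone_bdd f hXb hYb
    have hC := fun i => (fgProj_iff _).1 (cone_fg f hX hY i)
    obtain ⟨h₀, hh₀⟩ := lowSplit (Cone f) (fun i => (hC i).2) b hb m (m + 1) rfl hlow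
    obtain ⟨h₁, hh₁⟩ := hsplit
    obtain ⟨G, γ, hG, hGz, ⟨ρ, hρ⟩, hGs, hγ⟩ := exists_cell (Cone f) m (m + 1) (m + 1 + 1) rfl rfl
      (hC _).1 (hC _).1 h₀ hh₀ s (hS s hs) (hk _)
    obtain ⟨T⟩ := exists_twist γ
    -- exactness of `G`
    have hG0 : ∀ i j : ℤ, j + 1 = i → i ≠ m + 1 → ∀ g : G.X i, G.d i j g = 0 → g = 0 := by
      intro i j hij hi g hg
      by_cases h : i = m + 1 + 1
      · obtain rfl : j = m + 1 := by omega
        subst h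
        rw [← hρ g, hg, map_zero]
      · have := ModuleCat.subsingleton_of_isZero (hGz i hi h)
        exact Subsingleton.elim _ _
    have hG1 : ∀ (t : A[X]) (i j k : ℤ), j + 1 = i → i + 1 = k → i ≠ m + 1 → ∀ g : G.X i,
        G.d i j g = 0 → ∃ g', G.d k i g' = t • g := by
      intro t i j k hij hik hi g hg
      exact ⟨0, by rw [hG0 i j hij hi g hg, map_zero, smul_zero]⟩
    have hG2 : ∀ (i j k : ℤ), j + 1 = i → i + 1 = k → ∀ g : G.X i,
        G.d i j g = 0 → ∃ g', G.d k i g' = s • g := by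
      intro i j k hij hik g hg
      by_cases h : i = m + 1
      · obtain rfl : k = m + 1 + 1 := by omega
        subst h
        exact hGs g
      · exact hG1 s i j k hij hik h g hg
    have hZ : ∀ i, FGProjOverA A (T.Z.X i) := fun i => fgProj_prod (T.e i) (hX i) (hG i)
    have hZb : ∃ b : ℤ, ∀ i < b, IsZero (T.Z.X i) := by
      obtain ⟨b, hb⟩ := hXb
      exact ⟨min b (m + 1), fun i hi => isZero_prod (T.e i) (hb i (by omega))
        (hGz i (by omega) (by omega))⟩
    have hι : ∀ q : ℤ, q ≠ m + 1 → IsZero ((Cone T.ι).homology q) := by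
      intro q hq
      rw [isZero_iff_kill_one]
      exact iota_kill T q (q - 1) (q + 1) (q - 1 - 1) (by omega) rfl (by omega) 1
        (hG1 1 q (q - 1) (q + 1) (by omega) rfl hq)
    refine concl_cons S m f T.ι T.f' T.fac hX hι ?_ ⟨s, hs, ?_⟩ ?_
    · obtain ⟨b', hb'⟩ := cone_bdd T.ι hXb hZb
      obtain ⟨h₂, hh₂⟩ := lowSplit (Cone T.ι)
        (fun i => ((fgProj_iff _).1 (cone_fg T.ι hX hZ i)).2) b' hb' m (m + 1) rfl
        (fun q hq => hι q (by omega))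
      obtain ⟨h₃, hh₃⟩ := iota_split T (m + 1) m (m + 1 + 1) rfl rfl ρ hρ
      exact homology_fgProj (Cone T.ι) (m + 1) m (m + 1 + 1) rfl rfl (cone_fg T.ι hX hZ _)
        h₂ hh₂ h₃ hh₃
    · exact iota_kill T (m + 1) m (m + 1 + 1) (m - 1) rfl rfl (by omega) s
        (hG2 (m + 1) m (m + 1 + 1) rfl rfl)
    · have hex : ∀ q : ℤ, q ≠ m + 1 + 1 → IsZero ((Cone f).homology q) →
          IsZero ((Cone T.f').homology q) := by
        intro q hq hz
        rw [isZero_iff_kill_one] at hz ⊢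
        have := coneTw_kill T q (q - 1) (q + 1) (q - 1 - 1) (by omega) rfl (by omega) 1 1
          (hG1 1 (q - 1) (q - 1 - 1) q (by omega) (by omega) (by omega)) hz
        rwa [one_mul] at this
      have hd' : d = m + 1 + 1 + k := by push_cast at hd; omega
      refine ih T.Z hZb hZ T.f' (m + 1) d hd' ?_ ⟨s * s, S.mul_mem hs hs, ?_⟩ ?_ ?_
      · intro q hq
        by_cases h : q = m + 1
        · subst h
          exact coneTw_bot T (m + 1) m (m + 1 + 1) (m - 1) rfl rfl (by omega)
            (hGz m (by omega) (by omega)) hγ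
        · exact hex q (by omega) (hlow q (by omega))
      · intro q
        exact coneTw_kill T q (q - 1) (q + 1) (q - 1 - 1) (by omega) rfl (by omega) s s
          (hG2 (q - 1) (q - 1 - 1) q (by omega) (by omega)) (hk q)
      · intro q hq
        exact hex q (by omega) (hhigh q hq)
      · obtain ⟨ρ', hρ'⟩ : ∃ ρ' : G.X (d - 1) →ₗ[A] G.X d, ∀ u, ρ' (G.d d (d - 1) u) = u := by
          by_cases h : d = m + 1 + 1
          · obtain ⟨e, he⟩ : ∃ e, e = d - 1 := ⟨_, rfl⟩
            rw [← he]
            obtain rfl : e = m + 1 := by omega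
            subst h
            exact ⟨ρ, hρ⟩
          · have := ModuleCat.subsingleton_of_isZero (hGz d (by omega) h)
            exact ⟨0, fun u => Subsingleton.elim _ _⟩
        exact coneTw_split T d (d - 1) (d + 1) (by omega) rfl ρ' hρ' h₁ hh₁

theorem cone_kill_of {R : Type u} [CommRing R] {X Y : ChainComplex (ModuleCat.{u} R) ℤ}
    (f : X ⟶ Y) (p p' : R) (hX : ∀ (q : ℤ) (x : X.homology q), p • x = 0)
    (hY : ∀ (q : ℤ) (x : Y.homology q), p' • x = 0) (q : ℤ) :
    ∀ x : (Cone f).homology q, (p' * p) • x = 0 := by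
  rw [cone_kill_iff f q (q - 1) (q + 1) (q - 1 - 1) (by omega) rfl (by omega)]
  intro x y hx hy
  have hX' := (homology_kill_iff X (q - 1) (q - 1 - 1) q (by omega) (by omega) p).1 (hX _)
  have hY' := (homology_kill_iff Y q (q - 1) (q + 1) (by omega) rfl p').1 (hY _)
  obtain ⟨x1, hx1⟩ := hX' x hx
  obtain ⟨y1, hy1⟩ := hY' (p • y + f.f q x1) (by
    rw [map_add, map_smul, ← comm_apply, hx1, map_smul, ← smul_add, add_comm, hy, smul_zero])
  refine ⟨- (p' • x1), y1, ?_, ?_⟩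
  · rw [map_neg, map_smul, hx1, mul_smul, neg_neg]
  · rw [hy1, map_neg, map_smul, smul_add, mul_smul]
    abel

theorem final (S : Submonoid A[X]) (hS : ∀ p ∈ S, p.Monic)
    (X Y : ChainComplex (ModuleCat.{u} A[X]) ℤ)
    (hXb : ∃ b : ℤ, ∀ i, (i < 0 ∨ b < i) → IsZero (X.X i))
    (hYb : ∃ b : ℤ, ∀ i, (i < 0 ∨ b < i) → IsZero (Y.X i))
    (hXfg : ∀ i, FGProjOverA A (X.X i))
    (hYfg : ∀ i, FGProjOverA A (Y.X i))
    (hXtors : ∃ p ∈ S, ∀ (q : ℤ) (x : X.homology q), p • x = 0)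
    (hYtors : ∃ p ∈ S, ∀ (q : ℤ) (x : Y.homology q), p • x = 0)
    (m : ℤ) (f : X ⟶ Y)
    (hconn : ∀ q : ℤ, q ≤ m → IsZero ((Cone f).homology q)) : Concl S X Y m f := by
  obtain ⟨b, hb⟩ := hXb
  obtain ⟨b', hb'⟩ := hYb
  obtain ⟨p, hp, hpk⟩ := hXtors
  obtain ⟨p', hp', hpk'⟩ := hYtors
  obtain ⟨k, hk⟩ : ∃ k : ℕ, max (b + 1) b' ≤ m + 1 + k :=
    ⟨(max (b + 1) b' - (m + 1)).toNat, by omega⟩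
  have hz : ∀ i, m + 1 + k < i → IsZero ((Cone f).X i) := fun i hi =>
    cone_zero f i (hb _ (by omega)) (hb' _ (by omega))
  refine main S hS Y ⟨0, fun i hi => hb' i (Or.inl hi)⟩ hYfg k X ⟨0, fun i hi => hb i (Or.inl hi)⟩
    hXfg f m _ rfl hconn ⟨p' * p, S.mul_mem hp' hp, cone_kill_of f p p' hpk hpk'⟩ ?_ ?_
  · intro q hq
    have := ModuleCat.subsingleton_of_isZero (hz q hq)
    rw [homology_isZero_iff _ q (q - 1) (q + 1) (by omega) rfl]
    intro c _
    exact ⟨0, Subsingleton.elim _ _⟩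
  · have := ModuleCat.subsingleton_of_isZero (hz (m + 1 + k + 1) (by omega))
    refine ⟨0, fun c => ?_⟩
    rw [Subsingleton.elim c 0, map_zero, map_zero, map_zero]

end main

end Stmt12

end

/-- The torsion variant of the factorization: if moreover the homology of `X`
and of `Y` is annihilated by elements of a submonoid `S ⊆ A[t]` of monic polynomials, then
an `m`-connected `A[t]`-linear map `f : X ⟶ Y` factors as `X = Z_m → ⋯ → Z_n ≃ Y` where
each `cone(Z_{q−1} → Z_q)` has homology concentrated in degree `q`, where it is finitely
generated projective over `A` and annihilated by some element of `S`. -/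
theorem stmt12 {A : Type u} [CommRing A]
    (S : Submonoid (Polynomial A)) (hS : ∀ p ∈ S, p.Monic)
    (X Y : ChainComplex (ModuleCat.{u} (Polynomial A)) ℤ)
    (hXb : ∃ b : ℤ, ∀ i, (i < 0 ∨ b < i) → IsZero (X.X i))
    (hYb : ∃ b : ℤ, ∀ i, (i < 0 ∨ b < i) → IsZero (Y.X i))
    (hXfg : ∀ i, FGProjOverA A (X.X i))
    (hYfg : ∀ i, FGProjOverA A (Y.X i))
    (hXtors : ∃ p ∈ S, ∀ (q : ℤ) (x : X.homology q), p • x = 0)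
    (hYtors : ∃ p ∈ S, ∀ (q : ℤ) (x : Y.homology q), p • x = 0)
    (m : ℤ) (f : X ⟶ Y)
    (hconn : ∀ q : ℤ, q ≤ m → IsZero ((Cone f).homology q)) :
    ∃ (N : ℕ) (Z : ℕ → ChainComplex (ModuleCat.{u} (Polynomial A)) ℤ) (hZ0 : Z 0 = X)
      (φ : ∀ j, Z j ⟶ Z (j + 1)) (g : Z N ⟶ Y),
      (∀ j i, FGProjOverA A ((Z j).X i)) ∧
      QuasiIso g ∧
      eqToHom hZ0.symm ≫ compChain Z φ N ≫ g = f ∧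
      ∀ j : ℕ, j < N →
        (∀ q : ℤ, q ≠ m + (j : ℤ) + 1 → IsZero ((Cone (φ j)).homology q)) ∧
        FGProjOverA A ((Cone (φ j)).homology (m + (j : ℤ) + 1)) ∧
        ∃ p ∈ S, ∀ x : (Cone (φ j)).homology (m + (j : ℤ) + 1), p • x = 0 := by
  exact Stmt12.final S hS X Y hXb hYb hXfg hYfg hXtors hYtors m f hconn
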